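/- For every n ≥ 1 and every x ∈ ℝ: (n+1)/γ_{n+1} = (β_n − x) R_{n,n+1}(x) + γ_n R_{n−1,n+1}(x) + γ_{n+1} R_{n+1,n+1}(x). -/

import Mathlib

open MeasureTheory Polynomial Real

/-- Integration of polynomials against `exp (-V)`, as a linear functional. -/
noncomputable def expWeightFunctional (V : ℝ[X])
    (hint : ∀ q : ℝ[X], Integrable (fun x : ℝ => q.eval x * Real.exp (-(V.eval x)))) :
    ℝ[X] →ₗ[ℝ] ℝ where
  toFun q := ∫ x : ℝ, q.eval x * Real.exp (-(V.eval x))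
  map_add' q r := by
    rw [← integral_add (hint q) (hint r)]
    simp only [eval_add, add_mul]
  map_smul' c q := by
    simp only [eval_smul, smul_eq_mul, mul_assoc, integral_const_mul, RingHom.id_apply]

theorem expWeightFunctional_apply (V : ℝ[X])
    (hint : ∀ q : ℝ[X], Integrable (fun x : ℝ => q.eval x * Real.exp (-(V.eval x))))
    (q : ℝ[X]) :
    expWeightFunctional V hint q = ∫ x : ℝ, q.eval x * Real.exp (-(V.eval x)) := rfl

theorem expWeightFunctional_derivative_mul (V : ℝ[X])
    (hint : ∀ q : ℝ[X], Integrable (fun x : ℝ => q.eval x * Real.exp (-(V.eval x))))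
    (q : ℝ[X]) :
    expWeightFunctional V hint (derivative V * q) = expWeightFunctional V hint (derivative q) := by
  have hderiv : ∀ x : ℝ, HasDerivAt (fun x => q.eval x * Real.exp (-(V.eval x)))
      ((derivative q - derivative V * q).eval x * Real.exp (-(V.eval x))) x := by
    intro x
    refine ((q.hasDerivAt x).fun_mul (V.hasDerivAt x).fun_neg.exp).congr_deriv ?_
    rw [eval_sub, eval_mul]
    ring
  have key : expWeightFunctional V hint (derivative q - derivative V * q) = 0 :=
    integral_eq_zero_of_hasDerivAt_of_integrable hderiv (hint _) (hint q)
  rw [map_sub] at key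
  linarith

section OrthogonalPolynomials

variable {L : ℝ[X] →ₗ[ℝ] ℝ} {p : ℕ → ℝ[X]}

theorem degree_sub_C_coeff_mul_lt {q r : ℝ[X]} {k : ℕ} (hr : r.Monic) (hrdeg : r.natDegree = k)
    (hq : q.degree < (k + 1 : ℕ)) : (q - C (q.coeff k) * r).degree < k := by
  rw [degree_lt_iff_coeff_zero] at hq ⊢
  intro m hm
  rw [coeff_sub, coeff_C_mul]
  rcases hm.eq_or_lt with rfl | hlt
  · have : r.coeff k = 1 := by rw [← hrdeg]; exact hr
    rw [this, mul_one, sub_self]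
  · rw [coeff_eq_zero_of_natDegree_lt (by omega : r.natDegree < m), hq m hlt, mul_zero, sub_zero]

theorem orthogonal_of_degree_lt (hmonic : ∀ n, (p n).Monic) (hpdeg : ∀ n, (p n).natDegree = n)
    (horth : ∀ n m, n ≠ m → L (p n * p m) = 0) {n : ℕ} :
    ∀ {k : ℕ}, k ≤ n → ∀ {q : ℝ[X]}, q.degree < k → L (q * p n) = 0 := by
  intro k
  induction k with
  | zero =>
    intro _ q hq
    have : q = 0 := by simpa [degree_lt_iff_coeff_zero, Polynomial.ext_iff] using hq
    rw [this, zero_mul, map_zero]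
  | succ k ih =>
    intro hk q hq
    have h := ih (by omega) (degree_sub_C_coeff_mul_lt (hmonic k) (hpdeg k) hq)
    rwa [sub_mul, mul_assoc, map_sub, C_mul', map_smul, horth k n (by omega), smul_zero,
      sub_zero] at h

theorem functional_mul_eq_coeff_mul (hmonic : ∀ n, (p n).Monic)
    (hpdeg : ∀ n, (p n).natDegree = n)
    (horth : ∀ n m, n ≠ m → L (p n * p m) = 0) {n : ℕ} {q : ℝ[X]} (hq : q.natDegree ≤ n) :
    L (q * p n) = q.coeff n * L (p n * p n) := by
  have h := orthogonal_of_degree_lt hmonic hpdeg horth le_rfl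
    (degree_sub_C_coeff_mul_lt (hmonic n) (hpdeg n)
      ((natDegree_le_iff_degree_le.1 hq).trans_lt (by exact_mod_cast n.lt_succ_self)))
  rw [sub_mul, mul_assoc, map_sub, C_mul', map_smul, smul_eq_mul] at h
  linarith

theorem three_term_recurrence (hmonic : ∀ n, (p n).Monic) (hpdeg : ∀ n, (p n).natDegree = n)
    (horth : ∀ n m, n ≠ m → L (p n * p m) = 0) (hpos : ∀ n, 0 < L (p n * p n)) (n : ℕ) :
    X * p (n + 1) = p (n + 2)
      + C (L (X * p (n + 1) * p (n + 1)) / L (p (n + 1) * p (n + 1))) * p (n + 1)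
      + C (L (p (n + 1) * p (n + 1)) / L (p n * p n)) * p n := by
  have hlead : ∀ k, (p k).coeff k = 1 := fun k => by
    have := (hmonic k).coeff_natDegree
    rwa [hpdeg] at this
  have hvanish : ∀ k m, k < m → (p k).coeff m = 0 := fun k m hkm =>
    coeff_eq_zero_of_natDegree_lt ((hpdeg k).symm ▸ hkm)
  set b := L (X * p (n + 1) * p (n + 1)) / L (p (n + 1) * p (n + 1)) with hb
  set c := L (p (n + 1) * p (n + 1)) / L (p n * p n) with hc
  rw [← sub_eq_zero]
  set D := X * p (n + 1) - (p (n + 2) + C b * p (n + 1) + C c * p n) with hD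
  have hDdeg : D.natDegree ≤ n + 1 := by
    rw [natDegree_le_iff_coeff_eq_zero]
    intro m hm
    obtain ⟨m, rfl⟩ : ∃ k, m = k + 1 := ⟨m - 1, by omega⟩
    rw [hD, coeff_sub, coeff_add, coeff_add, coeff_X_mul, coeff_C_mul, coeff_C_mul,
      hvanish (n + 1) (m + 1) (by omega), hvanish n (m + 1) (by omega)]
    rcases eq_or_lt_of_le (show n + 1 ≤ m by omega) with rfl | hlt
    · rw [hlead, hlead]; ring
    · rw [hvanish _ _ hlt, hvanish (n + 2) (m + 1) (by omega)]; ring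
  have hLD : ∀ d, L (D * p d) = L (X * p (n + 1) * p d)
      - (L (p (n + 2) * p d) + b * L (p (n + 1) * p d) + c * L (p n * p d)) := by
    intro d
    rw [hD, sub_mul, add_mul, add_mul, mul_assoc (C b), mul_assoc (C c), C_mul', C_mul',
      map_sub, map_add, map_add, map_smul, map_smul, smul_eq_mul, smul_eq_mul]
  have hzero : L (D * p D.natDegree) = 0 := by
    generalize D.natDegree = d at hDdeg
    rw [hLD]
    rcases hDdeg.eq_or_lt with rfl | hlt
    · rw [horth (n + 2) (n + 1) (by omega), horth n (n + 1) (by omega), hb,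
        div_mul_cancel₀ _ (hpos _).ne']
      ring
    · have hcomm : X * p (n + 1) * p d = X * p d * p (n + 1) := by ring
      have hXd : (X * p d).natDegree ≤ n + 1 := by
        refine natDegree_mul_le.trans ?_
        rw [natDegree_X, hpdeg]
        omega
      rw [hcomm, functional_mul_eq_coeff_mul hmonic hpdeg horth hXd, coeff_X_mul,
        horth (n + 2) d (by omega), horth (n + 1) d (by omega)]
      rcases eq_or_lt_of_le (Nat.lt_succ_iff.1 hlt) with rfl | hlt'
      · rw [hlead, hc, div_mul_cancel₀ _ (hpos _).ne']
        ring
      · rw [hvanish _ _ hlt', horth n d (by omega)]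
        ring
  rw [functional_mul_eq_coeff_mul hmonic hpdeg horth le_rfl] at hzero
  exact leadingCoeff_eq_zero.1 ((mul_eq_zero.1 hzero).resolve_right (hpos _).ne')

end OrthogonalPolynomials

theorem stmt8
    (V : Polynomial ℝ)
    (hVeven : Even V.natDegree) (hVdeg : 2 ≤ V.natDegree)
    (hVlead : 0 < V.leadingCoeff)
    (hint : ∀ q : Polynomial ℝ,
      Integrable (fun x : ℝ => q.eval x * Real.exp (-(V.eval x))))
    (p : ℕ → Polynomial ℝ)
    (hmonic : ∀ n, (p n).Monic)
    (hpdeg : ∀ n, (p n).natDegree = n)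
    (horth : ∀ n m, n ≠ m →
      ∫ x : ℝ, (p n).eval x * (p m).eval x * Real.exp (-(V.eval x)) = 0)
    (h : ℕ → ℝ)
    (hh : ∀ n, h n = ∫ x : ℝ, ((p n).eval x) ^ 2 * Real.exp (-(V.eval x)))
    (hhpos : ∀ n, 0 < h n)
    (ψ : ℕ → ℝ → ℝ)
    (hψ : ∀ n x, ψ n x = (p n).eval x * Real.exp (-(V.eval x) / 2) / Real.sqrt (h n))
    (γ : ℕ → ℝ)
    (hγ : ∀ n, 1 ≤ n → γ n = Real.sqrt (h n / h (n - 1)))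
    (β : ℕ → ℝ)
    (hβ : ∀ n, β n = ∫ x : ℝ, x * (ψ n x) ^ 2)
    (W : ℝ → Polynomial ℝ)
    (hW : ∀ x : ℝ, (X - C x) * W x = derivative V - C ((derivative V).eval x))
    (R : ℕ → ℕ → ℝ → ℝ)
    (hR : ∀ i j (x : ℝ), R i j x = ∫ t : ℝ, (W x).eval t * ψ i t * ψ j t)
    (n : ℕ) (hn : 1 ≤ n) (x : ℝ) :
    ((n : ℝ) + 1) / γ (n + 1)
      = (β n - x) * R n (n + 1) x + γ n * R (n - 1) (n + 1) x
        + γ (n + 1) * R (n + 1) (n + 1) x := by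
  set L := expWeightFunctional V hint with hL
  have happ : ∀ q, L q = ∫ t : ℝ, q.eval t * Real.exp (-(V.eval t)) :=
    expWeightFunctional_apply V hint
  have horthL : ∀ i j, i ≠ j → L (p i * p j) = 0 := fun i j hij => by
    simpa only [happ, eval_mul] using horth i j hij
  have hLh : ∀ i, L (p i * p i) = h i := fun i => by
    simp only [happ, hh, eval_mul, pow_two]
  have hexp : ∀ t : ℝ,
      Real.exp (-(V.eval t) / 2) * Real.exp (-(V.eval t) / 2) = Real.exp (-(V.eval t)) :=
    fun t => by rw [← Real.exp_add, add_halves]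
  have hmoment : ∀ (q : ℝ[X]) (i j : ℕ), ∫ t : ℝ, q.eval t * ψ i t * ψ j t
      = L (q * (p i * p j)) / (√(h i) * √(h j)) := by
    intro q i j
    rw [happ, ← integral_div]
    congr 1 with t
    rw [hψ, hψ, ← hexp, eval_mul, eval_mul]
    ring
  have hsq : ∀ i, √(h i) * √(h i) = h i := fun i => Real.mul_self_sqrt (hhpos i).le
  obtain ⟨m, rfl⟩ : ∃ k, n = k + 1 := ⟨n - 1, by omega⟩
  have hβL : β (m + 1) = L (X * p (m + 1) * p (m + 1)) / L (p (m + 1) * p (m + 1)) := by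
    rw [hβ, hLh, mul_assoc, ← hsq (m + 1), ← hmoment]
    simp only [eval_X, pow_two, mul_assoc]
  have hrec := three_term_recurrence hmonic hpdeg horthL (fun i => by rw [hLh]; exact hhpos i) m
  rw [← hβL, hLh, hLh] at hrec
  have hexpand : (β (m + 1) - x) * L (W x * (p (m + 1) * p (m + 2)))
      + h (m + 1) / h m * L (W x * (p m * p (m + 2)))
      + L (W x * (p (m + 2) * p (m + 2)))
      = L (derivative V * (p (m + 1) * p (m + 2))) := by
    have hpoly : C (β (m + 1) - x) * (W x * (p (m + 1) * p (m + 2)))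
        + C (h (m + 1) / h m) * (W x * (p m * p (m + 2)))
        + W x * (p (m + 2) * p (m + 2))
        = derivative V * (p (m + 1) * p (m + 2))
          - C ((derivative V).eval x) * (p (m + 1) * p (m + 2)) := by
      rw [C_sub]
      linear_combination (p (m + 1) * p (m + 2)) * hW x - W x * p (m + 2) * hrec
    have := congrArg L hpoly
    simp only [C_mul'] at this
    simpa only [map_add, map_sub, map_smul, smul_eq_mul,
      horthL (m + 1) (m + 2) (by omega), mul_zero, sub_zero] using this
  have hderiv : L (derivative V * (p (m + 1) * p (m + 2))) = ((m : ℝ) + 2) * h (m + 1) := by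
    have hlow : (derivative (p (m + 1))).natDegree ≤ m + 1 := by
      have := natDegree_derivative_le (p (m + 1))
      rw [hpdeg] at this
      omega
    have htop : (derivative (p (m + 2))).natDegree ≤ m + 1 := by
      have := natDegree_derivative_le (p (m + 2))
      rwa [hpdeg] at this
    have hlead : (p (m + 2)).coeff (m + 1 + 1) = 1 := by
      have := (hmonic (m + 2)).coeff_natDegree
      rwa [hpdeg] at this
    rw [hL, expWeightFunctional_derivative_mul, ← hL, derivative_mul, map_add,
      functional_mul_eq_coeff_mul hmonic hpdeg horthL (hlow.trans (by omega)),
      coeff_eq_zero_of_natDegree_lt (by omega), mul_comm (p (m + 1)),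
      functional_mul_eq_coeff_mul hmonic hpdeg horthL htop, coeff_derivative, hlead, hLh, hLh]
    push_cast
    ring
  rw [hderiv] at hexpand
  have hγ₁ : γ (m + 1) = √(h (m + 1)) / √(h m) := by
    rw [hγ _ (by omega), Nat.add_sub_cancel, Real.sqrt_div (hhpos _).le]
  have hγ₂ : γ (m + 2) = √(h (m + 2)) / √(h (m + 1)) := by
    rw [hγ _ (by omega), show m + 2 - 1 = m + 1 from rfl, Real.sqrt_div (hhpos _).le]
  simp only [hR, hmoment, Nat.add_sub_cancel, show m + 1 + 1 = m + 2 from rfl, hγ₁, hγ₂]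
  rw [← hsq m, ← hsq (m + 1)] at hexpand
  have h₀ : √(h m) ≠ 0 := (Real.sqrt_pos.2 (hhpos _)).ne'
  have h₁ : √(h (m + 1)) ≠ 0 := (Real.sqrt_pos.2 (hhpos _)).ne'
  have h₂ : √(h (m + 2)) ≠ 0 := (Real.sqrt_pos.2 (hhpos _)).ne'
  field_simp at hexpand ⊢
  push_cast
  linear_combination -hexpand
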